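/- Let α₀ > 0, λ > 0, μ > 0, and β > 0. Define f(t) = (λ + μ|t|)·t·exp(α₀t² − β|t|) and F(t) = ∫₀ᵗ f(s) ds. Then there exist t₀ > 0 and M > 0 such that F(t) ≤ M·|f(t)| for all t with |t| ≥ t₀. -/

import Mathlib

open Real

/-- The primitive based at `0` of an odd function is even. -/
lemma integral_zero_abs_of_odd {f : ℝ → ℝ} (hodd : ∀ t, f (-t) = -f t) (t : ℝ) :
    ∫ s in (0:ℝ)..t, f s = ∫ s in (0:ℝ)..|t|, f s := by
  rcases abs_choice t with h | h
  · rw [h]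
  · have hneg := intervalIntegral.integral_comp_neg (a := 0) (b := t) f
    simp only [hodd, intervalIntegral.integral_neg, neg_zero] at hneg
    rw [h, intervalIntegral.integral_symm (-t) 0, ← hneg, neg_neg]

/-- If `b * g ≤ g'` on `[T, ∞)` with `b > 0` and `g T > 0`, then every primitive of `g` is
bounded on `[T, ∞)` by a multiple of `g`. -/
lemma exists_primitive_le_mul {g g' G : ℝ → ℝ} {b T : ℝ} (hb : 0 < b)
    (hG : ∀ t, HasDerivAt G (g t) t) (hg : ∀ t, HasDerivAt g (g' t) t)
    (hgT : 0 < g T) (hgpos : ∀ t, T ≤ t → 0 ≤ g t) (hle : ∀ t, T ≤ t → b * g t ≤ g' t) :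
    ∃ M > (0:ℝ), ∀ t, T ≤ t → G t ≤ M * g t := by
  have hM : 0 < 1 / b + |G T| / g T := by positivity
  refine ⟨1 / b + |G T| / g T, hM, fun t ht => ?_⟩
  set M := 1 / b + |G T| / g T with hMdef
  have hd : ∀ x, HasDerivAt (fun x => M * g x - G x) (M * g' x - g x) x := fun x =>
    ((hg x).const_mul M).sub (hG x)
  have hmono : MonotoneOn (fun x => M * g x - G x) (Set.Ici T) := by
    refine monotoneOn_of_deriv_nonneg (convex_Ici T)
      (fun x _ => (hd x).continuousAt.continuousWithinAt)
      (fun x _ => (hd x).differentiableAt.differentiableWithinAt) fun x hx => ?_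
    rw [interior_Ici] at hx
    have hx' : T ≤ x := le_of_lt hx
    rw [(hd x).deriv]
    have hMb : 1 ≤ M * b := by
      rw [hMdef, add_mul, one_div_mul_cancel hb.ne']
      have : 0 ≤ |G T| / g T * b := by positivity
      linarith
    nlinarith [mul_le_mul_of_nonneg_left (hle x hx') hM.le,
      mul_le_mul_of_nonneg_right hMb (hgpos x hx')]
  have hT : 0 ≤ M * g T - G T := by
    have h1 : M * g T = 1 / b * g T + |G T| := by
      rw [hMdef, add_mul, div_mul_cancel₀ _ hgT.ne']
    have h2 : 0 ≤ 1 / b * g T := by positivity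
    linarith [le_abs_self (G T)]
  have := hmono Set.self_mem_Ici (Set.mem_Ici.mpr ht) ht
  simp only at this
  linarith

theorem stmt_14 (α₀ lam μ β : ℝ) (hα₀ : 0 < α₀) (hlam : 0 < lam) (hμ : 0 < μ)
    (hβ : 0 < β)
    (f F : ℝ → ℝ)
    (hf : ∀ t : ℝ, f t = (lam + μ * |t|) * t * Real.exp (α₀ * t ^ 2 - β * |t|))
    (hF : ∀ t : ℝ, F t = ∫ s in (0:ℝ)..t, f s) :
    ∃ t₀ > (0:ℝ), ∃ M > (0:ℝ), ∀ t : ℝ, t₀ ≤ |t| → F t ≤ M * |f t| := by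
  set g : ℝ → ℝ := fun t => (lam + μ * t) * t * Real.exp (α₀ * t ^ 2 - β * t) with hgdef
  have hgcont : Continuous g := by fun_prop
  have hodd : ∀ t, f (-t) = -f t := fun t => by
    rw [hf, hf, abs_neg, neg_sq]
    ring
  have hFg : ∀ t, F t = ∫ s in (0:ℝ)..|t|, g s := fun t => by
    rw [hF, integral_zero_abs_of_odd hodd]
    refine intervalIntegral.integral_congr fun s hs => ?_
    rw [Set.uIcc_of_le (abs_nonneg t)] at hs
    simp only [hgdef, hf, abs_of_nonneg hs.1]
  have hfg : ∀ t, |f t| = g |t| := fun t => by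
    have : 0 ≤ lam + μ * |t| := by positivity
    simp only [hgdef, hf, abs_mul, abs_exp, sq_abs, abs_of_nonneg this]
  have hT : 0 < β / α₀ := div_pos hβ hα₀
  have hg : ∀ t, HasDerivAt g (((lam + 2 * μ * t) + (lam + μ * t) * t * (2 * α₀ * t - β)) *
      Real.exp (α₀ * t ^ 2 - β * t)) t := fun t => by
    have hp : HasDerivAt (fun t => (lam + μ * t) * t) (lam + 2 * μ * t) t := by
      refine ((((hasDerivAt_id' t).const_mul μ).const_add lam).mul
        (hasDerivAt_id' t)).congr_deriv ?_
      ring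
    have he : HasDerivAt (fun t => α₀ * t ^ 2 - β * t) (2 * α₀ * t - β) t := by
      refine (((hasDerivAt_pow 2 t).const_mul α₀).sub
        ((hasDerivAt_id' t).const_mul β)).congr_deriv ?_
      norm_num
      ring
    refine (hp.mul he.exp).congr_deriv ?_
    ring
  have hgpos : ∀ t, β / α₀ ≤ t → 0 < g t := fun t ht => by
    have : 0 < t := hT.trans_le ht
    simp only [hgdef]
    positivity
  obtain ⟨M, hM, hle⟩ := exists_primitive_le_mul hβ
    (fun t => hgcont.integral_hasStrictDerivAt 0 t |>.hasDerivAt) hg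
    (hgpos _ le_rfl) (fun t ht => (hgpos t ht).le) fun t ht => by
      have htpos : 0 < t := hT.trans_le ht
      have hβt : β ≤ t * α₀ := (div_le_iff₀ hα₀).mp ht
      simp only [hgdef]
      rw [← mul_assoc]
      refine mul_le_mul_of_nonneg_right ?_ (exp_pos _).le
      have h1 : 0 ≤ (lam + μ * t) * t := by positivity
      have h2 : 0 ≤ lam + 2 * μ * t := by positivity
      nlinarith [mul_nonneg h1 (sub_nonneg.mpr hβt)]
  exact ⟨β / α₀, hT, M, hM, fun t ht => by rw [hFg, hfg]; exact hle _ ht⟩
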